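/- If Ω is a proper subdomain of ℂ, then the generalized Hurwitz density with basepoint domain the unit disk coincides with the Hurwitz density: η_Ω^𝔻(w) = η_Ω(w) for every w ∈ Ω. -/

import Mathlib

open Complex Set Metric
open scoped ENNReal

noncomputable section

/-- The open unit disk in the complex plane. -/
def unitDisk : Set ℂ := Metric.ball (0 : ℂ) 1

/-- A plane domain: a nonempty open connected subset of ℂ. -/
def IsPlaneDomain (S : Set ℂ) : Prop := IsOpen S ∧ IsConnected S

/-- The Hurwitz radius `r_Ω(w)`: the supremum of `h'(0)` over all holomorphic
`h : 𝔻 → Ω` with `h 0 = w`, `h t ≠ w` for `t ∈ 𝔻 \ {0}`, and `h'(0) > 0` (real). -/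
def hurwitzRadius (Ω : Set ℂ) (w : ℂ) : ℝ :=
  sSup { r : ℝ | 0 < r ∧ ∃ h : ℂ → ℂ, DifferentiableOn ℂ h unitDisk ∧
    Set.MapsTo h unitDisk Ω ∧ h 0 = w ∧ (∀ t ∈ unitDisk, t ≠ 0 → h t ≠ w) ∧
    deriv h 0 = (r : ℂ) }

/-- The Hurwitz density `η_Ω(w) = 2 / r_Ω(w)`. -/
def hurwitzDensity (Ω : Set ℂ) (w : ℂ) : ℝ := 2 / hurwitzRadius Ω w

/-- A (C¹, hence rectifiable) path in `Ω` from `w₁` to `w₂`, parametrized on `[0,1]`. -/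
def IsPathIn (Ω : Set ℂ) (w₁ w₂ : ℂ) (γ : ℝ → ℂ) : Prop :=
  γ 0 = w₁ ∧ γ 1 = w₂ ∧ (∀ t ∈ Set.Icc (0:ℝ) 1, γ t ∈ Ω) ∧
    ContDiffOn ℝ 1 γ (Set.Icc (0:ℝ) 1)

/-- The Hurwitz distance: infimum of Hurwitz lengths of rectifiable paths in `Ω`. -/
def hurwitzDist (Ω : Set ℂ) (w₁ w₂ : ℂ) : ℝ :=
  sInf { L : ℝ | ∃ γ : ℝ → ℂ, IsPathIn Ω w₁ w₂ γ ∧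
    L = ∫ t in (0:ℝ)..1, hurwitzDensity Ω (γ t) * ‖derivWithin γ (Set.Icc (0:ℝ) 1) t‖ }

/-- The generalized Hurwitz density `η_Ω^Y(w)` with basepoint domain `Y`
(`+∞` if no admissible map exists). -/
def genHurwitzDensity (Y Ω : Set ℂ) (w : ℂ) : ℝ≥0∞ :=
  sInf { x : ℝ≥0∞ | ∃ s ∈ Y, ∃ h : ℂ → ℂ, DifferentiableOn ℂ h Y ∧
    Set.MapsTo h Y Ω ∧ h s = w ∧ (∀ t ∈ Y, t ≠ s → h t ≠ w) ∧ deriv h s ≠ 0 ∧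
    x = ENNReal.ofReal (hurwitzDensity Y s / ‖deriv h s‖) }

/-- The generalized Hurwitz distance `η_Ω^Y(z₁,z₂)`. -/
def genHurwitzDist (Y Ω : Set ℂ) (z₁ z₂ : ℂ) : ℝ≥0∞ :=
  sInf { L : ℝ≥0∞ | ∃ γ : ℝ → ℂ, IsPathIn Ω z₁ z₂ γ ∧
    L = ∫⁻ t in Set.Icc (0:ℝ) 1,
      genHurwitzDensity Y Ω (γ t) * ENNReal.ofReal ‖derivWithin γ (Set.Icc (0:ℝ) 1) t‖ }

/-- The infinitesimal contraction constant `l_η(Ω, Y)`. -/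
def lEta (Ω Y : Set ℂ) : ℝ :=
  sSup { x : ℝ | ∃ w ∈ Ω, x = hurwitzDensity Y w / hurwitzDensity Ω w }

/-- The global contraction constant `gl_η(Ω, Y)`. -/
def glEta (Ω Y : Set ℂ) : ℝ :=
  sSup { x : ℝ | ∃ w₁ ∈ Ω, ∃ w₂ ∈ Ω, w₁ ≠ w₂ ∧
    x = hurwitzDist Y w₁ w₂ / hurwitzDist Ω w₁ w₂ }

/-- The derivatives `h'(0) > 0` competing in the definition of the Hurwitz radius. -/
def hurwitzDerivs (Ω : Set ℂ) (w : ℂ) : Set ℝ :=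
  { r : ℝ | 0 < r ∧ ∃ h : ℂ → ℂ, DifferentiableOn ℂ h unitDisk ∧
    Set.MapsTo h unitDisk Ω ∧ h 0 = w ∧ (∀ t ∈ unitDisk, t ≠ 0 → h t ≠ w) ∧
    deriv h 0 = (r : ℂ) }

/-- The disk automorphism `z ↦ (z + s) / (1 + conj s * z)`. -/
def diskShift (s z : ℂ) : ℂ := (z + s) / (1 + (starRingEnd ℂ) s * z)

lemma mem_unitDisk {z : ℂ} : z ∈ unitDisk ↔ ‖z‖ < 1 := by
  simp [unitDisk]

lemma isOpen_unitDisk : IsOpen unitDisk := Metric.isOpen_ball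

lemma one_sub_norm_sq_pos {s : ℂ} (hs : s ∈ unitDisk) : 0 < 1 - ‖s‖ ^ 2 := by
  have := mem_unitDisk.1 hs
  nlinarith [norm_nonneg s]

lemma one_add_conj_mul_ne_zero {s z : ℂ} (hs : s ∈ unitDisk) (hz : z ∈ unitDisk) :
    1 + (starRingEnd ℂ) s * z ≠ 0 := by
  intro h
  have h1 : ‖(starRingEnd ℂ) s * z‖ = 1 := by
    rw [eq_neg_of_add_eq_zero_right h]; simp
  rw [norm_mul, RCLike.norm_conj] at h1
  have := mem_unitDisk.1 hs
  have := mem_unitDisk.1 hz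
  nlinarith [norm_nonneg s, norm_nonneg z]

lemma diskShift_mem {s z : ℂ} (hs : s ∈ unitDisk) (hz : z ∈ unitDisk) :
    diskShift s z ∈ unitDisk := by
  have hne := one_add_conj_mul_ne_zero hs hz
  rw [mem_unitDisk, diskShift, norm_div, div_lt_one (norm_pos_iff.2 hne)]
  apply lt_of_pow_lt_pow_left₀ 2 (norm_nonneg _)
  have key : ‖1 + (starRingEnd ℂ) s * z‖ ^ 2 - ‖z + s‖ ^ 2
      = (1 - ‖s‖ ^ 2) * (1 - ‖z‖ ^ 2) := by
    simp only [Complex.sq_norm, Complex.normSq_apply, Complex.add_re, Complex.add_im,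
      Complex.mul_re, Complex.mul_im, Complex.conj_re, Complex.conj_im, Complex.one_re,
      Complex.one_im]
    ring
  have := mul_pos (one_sub_norm_sq_pos hs) (one_sub_norm_sq_pos hz)
  linarith

lemma diskShift_zero (s : ℂ) : diskShift s 0 = s := by simp [diskShift]

lemma diskShift_neg_self (s : ℂ) : diskShift (-s) s = 0 := by simp [diskShift]

lemma conj_mul_self_eq (s : ℂ) : (starRingEnd ℂ) s * s = ((‖s‖ ^ 2 : ℝ) : ℂ) := by
  rw [Complex.conj_mul']; push_cast; rfl

lemma eq_zero_of_diskShift_eq {s z : ℂ} (hs : s ∈ unitDisk) (hz : z ∈ unitDisk)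
    (h : diskShift s z = s) : z = 0 := by
  rw [diskShift, div_eq_iff (one_add_conj_mul_ne_zero hs hz)] at h
  have h2 : z * ((1 - ‖s‖ ^ 2 : ℝ) : ℂ) = 0 := by
    rw [Complex.ofReal_sub, ← conj_mul_self_eq, Complex.ofReal_one]
    linear_combination h
  exact (mul_eq_zero.1 h2).resolve_right
    (Complex.ofReal_ne_zero.2 (one_sub_norm_sq_pos hs).ne')

lemma hasDerivAt_diskShift {s z : ℂ} (hs : s ∈ unitDisk) (hz : z ∈ unitDisk) :
    HasDerivAt (diskShift s)
      (((1 - ‖s‖ ^ 2 : ℝ) : ℂ) / (1 + (starRingEnd ℂ) s * z) ^ 2) z := by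
  have h1 : HasDerivAt (fun z : ℂ => z + s) 1 z := (hasDerivAt_id z).add_const s
  have h2 : HasDerivAt (fun z : ℂ => 1 + (starRingEnd ℂ) s * z) ((starRingEnd ℂ) s) z := by
    simpa using ((hasDerivAt_id z).const_mul ((starRingEnd ℂ) s)).const_add 1
  refine (h1.div h2 (one_add_conj_mul_ne_zero hs hz)).congr_deriv ?_
  rw [Complex.ofReal_sub, ← conj_mul_self_eq, Complex.ofReal_one]
  ring

/-- Moving the base point of an admissible map to the origin and normalizing its derivative. -/
lemma mul_norm_deriv_mem_hurwitzDerivs {Ω : Set ℂ} {w s : ℂ} {h : ℂ → ℂ} (hs : s ∈ unitDisk)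
    (hd : DifferentiableOn ℂ h unitDisk) (hm : Set.MapsTo h unitDisk Ω) (hsw : h s = w)
    (hne : ∀ t ∈ unitDisk, t ≠ s → h t ≠ w) (h0 : deriv h s ≠ 0) :
    (1 - ‖s‖ ^ 2) * ‖deriv h s‖ ∈ hurwitzDerivs Ω w := by
  have hn : (‖deriv h s‖ : ℂ) ≠ 0 := by simpa using h0
  set c : ℂ := (‖deriv h s‖ : ℂ) / deriv h s with hc
  have hc1 : ‖c‖ = 1 := by simp [hc, h0]
  have hc0 : c ≠ 0 := div_ne_zero hn h0
  have hz0 : (0 : ℂ) ∈ unitDisk := by simp [mem_unitDisk]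
  have hcm : ∀ t ∈ unitDisk, c * t ∈ unitDisk := fun t ht => by
    rw [mem_unitDisk, norm_mul, hc1, one_mul]; exact mem_unitDisk.1 ht
  have hat : ∀ z ∈ unitDisk, DifferentiableAt ℂ h z := fun z hz =>
    hd.differentiableAt (isOpen_unitDisk.mem_nhds hz)
  have hder : ∀ t ∈ unitDisk, HasDerivAt (fun t => h (diskShift s (c * t)))
      (deriv h (diskShift s (c * t)) *
        (((1 - ‖s‖ ^ 2 : ℝ) : ℂ) / (1 + (starRingEnd ℂ) s * (c * t)) ^ 2 * c)) t := fun t ht => by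
    have h1 : HasDerivAt (fun t : ℂ => c * t) c t := by
      simpa using (hasDerivAt_id t).const_mul c
    exact (hat _ (diskShift_mem hs (hcm t ht))).hasDerivAt.comp t
      ((hasDerivAt_diskShift hs (hcm t ht)).comp t h1)
  refine ⟨mul_pos (one_sub_norm_sq_pos hs) (norm_pos_iff.2 h0),
    fun t => h (diskShift s (c * t)), fun t ht => (hder t ht).differentiableAt.differentiableWithinAt,
    fun t ht => hm (diskShift_mem hs (hcm t ht)), by simp [diskShift_zero, hsw],
    fun t ht ht0 => hne _ (diskShift_mem hs (hcm t ht)) fun he => ?_, ?_⟩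
  · exact mul_ne_zero hc0 ht0 (eq_zero_of_diskShift_eq hs (hcm t ht) he)
  · rw [(hder 0 hz0).deriv, mul_zero, diskShift_zero, mul_zero, add_zero, one_pow, div_one, hc]
    push_cast
    field_simp

lemma hurwitzRadius_unitDisk {s : ℂ} (hs : s ∈ unitDisk) :
    hurwitzRadius unitDisk s = 1 - ‖s‖ ^ 2 := by
  have hpos := one_sub_norm_sq_pos hs
  have hns : -s ∈ unitDisk := by simpa [mem_unitDisk] using hs
  have hz0 : (0 : ℂ) ∈ unitDisk := by simp [mem_unitDisk]
  apply IsGreatest.csSup_eq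
  constructor
  · have hmem := mul_norm_deriv_mem_hurwitzDerivs (Ω := unitDisk) (w := s) (h := id) hs
      differentiableOn_id (Set.mapsTo_id _) rfl (fun _ _ h => h) (by simp)
    rwa [deriv_id, norm_one, mul_one] at hmem
  · rintro r ⟨hr, h, hd, hm, h0, -, hder⟩
    have hat : ∀ z ∈ unitDisk, DifferentiableAt ℂ h z := fun z hz =>
      hd.differentiableAt (isOpen_unitDisk.mem_nhds hz)
    have hgd : DifferentiableOn ℂ (diskShift (-s) ∘ h) (ball 0 1) := fun z hz =>
      ((hasDerivAt_diskShift hns (hm hz)).differentiableAt.comp z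
        (hat z hz)).differentiableWithinAt
    have hgm : Set.MapsTo (diskShift (-s) ∘ h) (ball 0 1) (ball 0 1) := fun z hz =>
      diskShift_mem hns (hm hz)
    have hg0 : (diskShift (-s) ∘ h) 0 = 0 := by simp [h0, diskShift_neg_self]
    have hle := Complex.norm_deriv_le_one_of_mapsTo_ball hgd
      (by rw [hg0]; exact hgm.mono_right ball_subset_closedBall) one_pos
    have hcomp := (hasDerivAt_diskShift hns (hm hz0)).comp 0 (hat 0 hz0).hasDerivAt
    have heq : 1 + (starRingEnd ℂ) (-s) * s = ((1 - ‖s‖ ^ 2 : ℝ) : ℂ) := by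
      rw [Complex.ofReal_sub, ← conj_mul_self_eq, map_neg]; push_cast; ring
    rw [hcomp.deriv, hder, h0, heq, norm_mul, norm_div, norm_pow, norm_neg, Complex.norm_real,
      Complex.norm_real, Real.norm_of_nonneg hpos.le, Real.norm_of_nonneg hr.le] at hle
    have : (1 - ‖s‖ ^ 2) / (1 - ‖s‖ ^ 2) ^ 2 * r = r / (1 - ‖s‖ ^ 2) := by
      field_simp
    rwa [this, div_le_one hpos] at hle

lemma genHurwitzDensity_unitDisk_eq_sInf (Ω : Set ℂ) (w : ℂ) :
    genHurwitzDensity unitDisk Ω w =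
      sInf ((fun r => ENNReal.ofReal (2 / r)) '' hurwitzDerivs Ω w) := by
  have hz0 : (0 : ℂ) ∈ unitDisk := by simp [mem_unitDisk]
  unfold genHurwitzDensity
  congr 1
  ext x
  constructor
  · rintro ⟨s, hs, h, hd, hm, hsw, hne, h0, rfl⟩
    refine ⟨_, mul_norm_deriv_mem_hurwitzDerivs hs hd hm hsw hne h0, ?_⟩
    simp only [hurwitzDensity, hurwitzRadius_unitDisk hs, div_div]
  · rintro ⟨r, ⟨hr, h, hd, hm, h0, hne, hder⟩, rfl⟩
    refine ⟨0, hz0, h, hd, hm, h0, hne, ?_, ?_⟩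
    · rw [hder]; exact Complex.ofReal_ne_zero.2 hr.ne'
    · simp [hurwitzDensity, hurwitzRadius_unitDisk hz0, hder, abs_of_pos hr]

lemma hurwitzDerivs_nonempty {Ω : Set ℂ} (hΩ : IsOpen Ω) {w : ℂ} (hw : w ∈ Ω) :
    (hurwitzDerivs Ω w).Nonempty := by
  obtain ⟨ε, hε, hsub⟩ := Metric.isOpen_iff.1 hΩ w hw
  have hder : ∀ t : ℂ, HasDerivAt (fun t : ℂ => w + (ε : ℂ) * t) (ε : ℂ) t := fun t => by
    simpa using ((hasDerivAt_id t).const_mul (ε : ℂ)).const_add w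
  refine ⟨ε, hε, fun t => w + (ε : ℂ) * t,
    fun t _ => (hder t).differentiableAt.differentiableWithinAt, fun t ht => hsub ?_, by simp,
    fun t _ ht => by simp [ht, hε.ne'], (hder 0).deriv⟩
  have := mem_unitDisk.1 ht
  simp only [Metric.mem_ball, dist_self_add_left, norm_mul, Complex.norm_real,
    Real.norm_of_nonneg hε.le]
  nlinarith

/-- If `A` is unbounded, both sides vanish, because then `sSup A = 0`. -/
lemma sInf_image_ofReal_two_div {A : Set ℝ} (hA : A.Nonempty) (hpos : ∀ r ∈ A, 0 < r) :
    sInf ((fun r => ENNReal.ofReal (2 / r)) '' A) = ENNReal.ofReal (2 / sSup A) := by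
  by_cases hb : BddAbove A
  · obtain ⟨r₀, hr₀⟩ := hA
    have hS : 0 < sSup A := (hpos r₀ hr₀).trans_le (le_csSup hb hr₀)
    apply le_antisymm
    · refine le_of_forall_gt fun b hlt => ?_
      rcases eq_or_ne b ⊤ with rfl | hbt
      · exact (sInf_le (mem_image_of_mem _ hr₀)).trans_lt ENNReal.ofReal_lt_top
      · have hbS : 2 / sSup A < b.toReal :=
          (ENNReal.ofReal_lt_iff_lt_toReal (by positivity) hbt).1 hlt
        have hbp : 0 < b.toReal := lt_trans (by positivity) hbS
        obtain ⟨r, hr, hbr⟩ := exists_lt_of_lt_csSup ⟨r₀, hr₀⟩ ((div_lt_comm₀ hS hbp).1 hbS)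
        refine (sInf_le (mem_image_of_mem _ hr)).trans_lt ?_
        rw [ENNReal.ofReal_lt_iff_lt_toReal (div_nonneg two_pos.le (hpos r hr).le) hbt]
        exact (div_lt_comm₀ (hpos r hr) hbp).2 hbr
    · refine le_sInf ?_
      rintro _ ⟨r, hr, rfl⟩
      exact ENNReal.ofReal_le_ofReal
        (div_le_div_of_nonneg_left two_pos.le (hpos r hr) (le_csSup hb hr))
  · rw [Real.sSup_of_not_bddAbove hb, div_zero, ENNReal.ofReal_zero]
    refine le_antisymm (le_of_forall_gt fun b hlt => ?_) bot_le
    rcases eq_or_ne b ⊤ with rfl | hbt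
    · obtain ⟨r₀, hr₀⟩ := hA
      exact (sInf_le (mem_image_of_mem _ hr₀)).trans_lt ENNReal.ofReal_lt_top
    · have hbp : 0 < b.toReal := ENNReal.toReal_pos hlt.ne' hbt
      obtain ⟨r, hr, hbr⟩ := not_bddAbove_iff.1 hb (2 / b.toReal)
      refine (sInf_le (mem_image_of_mem _ hr)).trans_lt ?_
      rw [ENNReal.ofReal_lt_iff_lt_toReal (div_nonneg two_pos.le (hpos r hr).le) hbt]
      exact (div_lt_comm₀ (hpos r hr) hbp).2 hbr

/-- for a proper subdomain `Ω ⊊ ℂ`, the generalized Hurwitz density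
with basepoint domain `𝔻` coincides with the Hurwitz density. -/
theorem genHurwitz_disk_eq_hurwitz
    (Ω : Set ℂ) (hΩ : IsPlaneDomain Ω) (hΩp : Ω ≠ Set.univ) (w : ℂ) (hw : w ∈ Ω) :
    genHurwitzDensity unitDisk Ω w = ENNReal.ofReal (hurwitzDensity Ω w) := by
  rw [genHurwitzDensity_unitDisk_eq_sInf,
    sInf_image_ofReal_two_div (hurwitzDerivs_nonempty hΩ.1 hw) fun _ hr => hr.1]
  rfl
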